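/- Let p ≥ 7 be a prime and ζ ∈ ℂ a primitive p-th root of unity. For integers a, b coprime to p set L_ζ(a,b) = ((ζ^a + 1)/(ζ^a − 1)) · ((ζ^b + 1)/(ζ^b − 1)), where ζ^a denotes the integer power of the nonzero complex number ζ. Let (a_i, b_i, λ_i) for i = 1,…,n and (ã_j, b̃_j, λ̃_j) for j = 1,…,m be triples of integers with all a_i, b_i, ã_j, b̃_j coprime to p, and let α, c, μ be integers with c coprime to p. Let h ∈ ℤ[X] be a polynomial with p dividing h(1). Assume the identity in ℂ: h(ζ) = Σ_{i=1}^n L_ζ(a_i,b_i)(ζ^{λ_i} + ζ^{−λ_i}) − Σ_{j=1}^m L_ζ(ã_j,b̃_j)(ζ^{λ̃_j} + ζ^{−λ̃_j}) + 4α ζ^c (ζ^{μ} + ζ^{−μ})/(ζ^c − 1)². Then the following equalities hold in the field ZMod p (inverses taken in ZMod p): Σ_i (a_i b_i)⁻¹ − Σ_j (ã_j b̃_j)⁻¹ + α(c²)⁻¹ = 0, and Σ_i (6λ_i² + a_i² + b_i² + 1)(a_i b_i)⁻¹ − Σ_j (6λ̃_j² + ã_j² + b̃_j² + 1)(ã_j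 b̃_j)⁻¹ − α(c² − 1 − 6μ²)(c²)⁻¹ = 0. -/

import Mathlib

open Finset

/-- The Lefschetz-number expression `((ζ^a+1)/(ζ^a-1))·((ζ^b+1)/(ζ^b-1))`. -/
noncomputable def Lz (ζ : ℂ) (a b : ℤ) : ℂ :=
  ((ζ ^ a + 1) / (ζ ^ a - 1)) * ((ζ ^ b + 1) / (ζ ^ b - 1))

open Polynomial in
/-- Reduction modulo `p` of `ℤ[ζ]`, sending `ζ` to any `t` with `(t - 1) ^ (p - 1) = 0`. -/
lemma exists_adjoin_ringHom {p : ℕ} (hp : p.Prime) {ζ : ℂ} (hζ : IsPrimitiveRoot ζ p)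
    {A : Type*} [CommRing A] [Algebra (ZMod p) A] (t : A) (ht : (t - 1) ^ (p - 1) = 0) :
    ∃ φ : Algebra.adjoin ℤ {ζ} →+* A,
      φ ⟨ζ, Algebra.self_mem_adjoin_singleton ℤ ζ⟩ = t := by
  have : Fact p.Prime := ⟨hp⟩
  have hint : IsIntegral ℤ ζ := hζ.isIntegral hp.pos
  have hcyc : cyclotomic p (ZMod p) = (X - 1) ^ (p - 1) := by
    have := cyclotomic_mul_prime_eq_pow_of_not_dvd (ZMod p) (p := p) (n := 1) hp.not_dvd_one
    simpa using this
  have hcast : Int.castRingHom A = (algebraMap (ZMod p) A).comp (Int.castRingHom (ZMod p)) :=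
    RingHom.ext_int _ _
  have hroot : (minpoly ℤ ζ).eval₂ (Int.castRingHom A) t = 0 := by
    rw [← cyclotomic_eq_minpoly hζ hp.pos, hcast, ← eval₂_map, map_cyclotomic, hcyc]
    simpa using ht
  refine ⟨(AdjoinRoot.lift (Int.castRingHom A) t hroot).comp
    ((minpoly.equivAdjoin hint).symm : _ →+* _), ?_⟩
  have h1 : minpoly.equivAdjoin hint (AdjoinRoot.root _)
      = ⟨ζ, Algebra.self_mem_adjoin_singleton ℤ ζ⟩ := by
    apply Subtype.ext
    simp [minpoly.equivAdjoin, AdjoinRoot.Minpoly.toAdjoin]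
  rw [RingHom.comp_apply, ← h1]
  exact (congrArg _ ((minpoly.equivAdjoin hint).symm_apply_apply _)).trans
    (AdjoinRoot.lift_root hroot)

/-- The exponential `exp (12 k y)` truncated at order `4`. -/
def truncExp {A : Type*} [CommRing A] (y k : A) : A :=
  1 + 12 * k * y + 72 * k ^ 2 * y ^ 2 + 288 * k ^ 3 * y ^ 3

section truncExp

variable {A : Type*} [CommRing A] {y : A}

lemma truncExp_add (hy : y ^ 4 = 0) (k l : A) :
    truncExp y (k + l) = truncExp y k * truncExp y l := by
  simp only [truncExp]
  linear_combination (-(12 * k * 288 * l ^ 3 + 72 * k ^ 2 * 72 * l ^ 2 + 288 * k ^ 3 * 12 * l)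
    - (72 * k ^ 2 * 288 * l ^ 3 + 288 * k ^ 3 * 72 * l ^ 2) * y
    - 288 * k ^ 3 * 288 * l ^ 3 * y ^ 2) * hy

lemma map_zpow_eq_truncExp {R : Type*} [CommRing R] (hy : y ^ 4 = 0) (φ : R →+* A) (z : Rˣ)
    (hz : φ z = truncExp y 1) (k : ℤ) : φ ((z ^ k : Rˣ) : R) = truncExp y (k : A) := by
  have h0 : truncExp y 0 = 1 := by simp [truncExp]
  have hinv : φ ((z⁻¹ : Rˣ) : R) = truncExp y (-1) := by
    have h1 : φ z * φ ((z⁻¹ : Rˣ) : R) = 1 := by rw [← map_mul]; simp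
    have h2 : truncExp y (-1) * φ z = 1 := by rw [hz, ← truncExp_add hy]; simp [h0]
    linear_combination truncExp y (-1) * h1 - φ ((z⁻¹ : Rˣ) : R) * h2
  induction k using Int.induction_on with
  | zero => simp [h0]
  | succ i ih =>
    rw [zpow_add_one, Units.val_mul, map_mul, ih, hz, ← truncExp_add hy]; push_cast; rfl
  | pred i ih =>
    rw [zpow_sub_one, Units.val_mul, map_mul, ih, hinv, ← truncExp_add hy]
    push_cast
    rw [sub_eq_add_neg]

lemma mul_eq_of_mul_truncExp_sub_one (hy : y ^ 4 = 0) {U k u w : A} (hu : k * u = 1)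
    (hw : 12 * w = 1) (hU : U * (truncExp y k - 1) = truncExp y 1 - 1) :
    y * U = y * ((1 + 6 * y + 24 * y ^ 2) * u * (1 - 6 * k * y + 12 * k ^ 2 * y ^ 2)) := by
  simp only [truncExp] at hU
  have h1 : U * k * (y + 6 * k * y ^ 2 + 24 * k ^ 2 * y ^ 3) = y + 6 * y ^ 2 + 24 * y ^ 3 := by
    linear_combination w * hU - (U * k * (y + 6 * k * y ^ 2 + 24 * k ^ 2 * y ^ 3)
      - (y + 6 * y ^ 2 + 24 * y ^ 3)) * hw
  linear_combination u * (1 - 6 * k * y + 12 * k ^ 2 * y ^ 2) * h1 - U * y * hu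
    - U * k * u * (-72 * k ^ 3 + 288 * k ^ 4 * y) * hy

lemma fixedPoint_term (hy : y ^ 4 = 0) {U V k l u v r w : A} (hu : k * u = 1) (hv : l * v = 1)
    (hw : 12 * w = 1) (hU : U * (truncExp y k - 1) = truncExp y 1 - 1)
    (hV : V * (truncExp y l - 1) = truncExp y 1 - 1) :
    y * (U * (truncExp y k + 1) * (V * (truncExp y l + 1)) * (truncExp y r + truncExp y (-r)))
      = 8 * (1 + 6 * y + 24 * y ^ 2) ^ 2
        * (y * (u * v + 12 * ((6 * r ^ 2 + k ^ 2 + l ^ 2) * (u * v)) * y ^ 2)) := by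
  have key : ∀ {U k u : A}, k * u = 1 → U * (truncExp y k - 1) = truncExp y 1 - 1 →
      y * (U * (truncExp y k + 1))
        = y * ((1 + 6 * y + 24 * y ^ 2) * u * (2 + 24 * k ^ 2 * y ^ 2)) := by
    intro U k u hu hU
    have h := mul_eq_of_mul_truncExp_sub_one hy hu hw hU
    simp only [truncExp]
    linear_combination (2 + 12 * k * y + 72 * k ^ 2 * y ^ 2 + 288 * k ^ 3 * y ^ 3) * h
      + (1 + 6 * y + 24 * y ^ 2) * u * (-864 * k ^ 4 * y + 3456 * k ^ 5 * y ^ 2) * hy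
  have hk := key hu hU
  have hl := key hv hV
  have hr : truncExp y r + truncExp y (-r) = 2 + 144 * r ^ 2 * y ^ 2 := by
    simp only [truncExp]; ring
  rw [hr]
  linear_combination (V * (truncExp y l + 1)) * (2 + 144 * r ^ 2 * y ^ 2) * hk
    + (1 + 6 * y + 24 * y ^ 2) * u * (2 + 24 * k ^ 2 * y ^ 2) * (2 + 144 * r ^ 2 * y ^ 2) * hl
    + (1 + 6 * y + 24 * y ^ 2) ^ 2 * u * v * y * (2 * 24 * 24 * k ^ 2 * l ^ 2
      + 2 * 24 * 144 * (k ^ 2 + l ^ 2) * r ^ 2 + 24 * 24 * 144 * k ^ 2 * l ^ 2 * r ^ 2 * y ^ 2) * hy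

lemma fixedSphere_term (hy : y ^ 4 = 0) {U k u r w s : A} (hu : k * u = 1)
    (hw : 12 * w = 1) (hU : U * (truncExp y k - 1) = truncExp y 1 - 1) :
    y * (4 * s * truncExp y k * U ^ 2 * (truncExp y r + truncExp y (-r)))
      = 8 * (1 + 6 * y + 24 * y ^ 2) ^ 2
        * (y * (s * u ^ 2 + 12 * (s * (6 * r ^ 2 - k ^ 2) * u ^ 2) * y ^ 2)) := by
  have h := mul_eq_of_mul_truncExp_sub_one hy hu hw hU
  have hr : truncExp y r + truncExp y (-r) = 2 + 144 * r ^ 2 * y ^ 2 := by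
    simp only [truncExp]; ring
  have h2 : y * U ^ 2 * truncExp y k
      = y * ((1 + 6 * y + 24 * y ^ 2) ^ 2 * u ^ 2 * (1 - 12 * k ^ 2 * y ^ 2)) := by
    simp only [truncExp]
    linear_combination (1 + 12 * k * y + 72 * k ^ 2 * y ^ 2 + 288 * k ^ 3 * y ^ 3) *
      (U + (1 + 6 * y + 24 * y ^ 2) * u * (1 - 6 * k * y + 12 * k ^ 2 * y ^ 2)) * h
      + (1 + 6 * y + 24 * y ^ 2) ^ 2 * u ^ 2 * (-720 * k ^ 4 * y + 8640 * k ^ 5 * y ^ 2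
        - 31104 * k ^ 6 * y ^ 3 + 41472 * k ^ 7 * y ^ 4) * hy
  rw [hr]
  linear_combination 4 * s * (2 + 144 * r ^ 2 * y ^ 2) * h2
    - 4 * s * (1 + 6 * y + 24 * y ^ 2) ^ 2 * u ^ 2 * y * 12 * 144 * k ^ 2 * r ^ 2 * hy

end truncExp

/-- If `z ^ p = 1`, then `z - 1` is a multiple of `z ^ k - 1` for `k` prime to `p`. -/
lemma exists_mul_zpow_sub_one {R : Type*} [CommRing R] {p : ℕ} [Fact p.Prime] (z : Rˣ)
    (hz : z ^ p = 1) {k : ℤ} (hk : (k : ZMod p) ≠ 0) :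
    ∃ U : R, U * (((z ^ k : Rˣ) : R) - 1) = z - 1 := by
  refine ⟨∑ i ∈ range ((k : ZMod p)⁻¹).val, ((z ^ k : Rˣ) : R) ^ i, ?_⟩
  have h1 : (z ^ k) ^ ((k : ZMod p)⁻¹).val = z := by
    have h2 : (p : ℤ) ∣ k * (((k : ZMod p)⁻¹).val : ℤ) - 1 := by
      rw [← ZMod.intCast_zmod_eq_zero_iff_dvd]
      simp [hk]
    obtain ⟨q, hq⟩ := h2
    rw [← zpow_natCast, ← zpow_mul, eq_add_of_sub_eq hq, zpow_add_one, zpow_mul, zpow_natCast, hz]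
    simp
  rw [geom_sum_mul, ← Units.val_pow_eq_pow_val, h1]

open Polynomial in
/-- Over a field, `y * (c + 12 * d * y ^ 2)` vanishes modulo `y ^ 4` only if `c` and `d` do. -/
lemma eq_zero_of_root_mul_eq_zero {K : Type*} [Field K] (h12 : (12 : K) ≠ 0) {c d : K}
    (h : AdjoinRoot.root (X ^ 4 : K[X]) * (algebraMap K _ c
      + 12 * algebraMap K _ d * AdjoinRoot.root (X ^ 4 : K[X]) ^ 2) = 0) : c = 0 ∧ d = 0 := by
  have h1 : AdjoinRoot.mk (X ^ 4 : K[X]) (X * (C c + 12 * C d * X ^ 2)) = 0 := by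
    rw [← h]
    simp only [map_mul, map_add, map_pow, AdjoinRoot.mk_X, AdjoinRoot.mk_C, map_ofNat,
      AdjoinRoot.algebraMap_eq]
  rw [AdjoinRoot.mk_eq_zero, X_pow_dvd_iff] at h1
  have e : X * (C c + 12 * C d * X ^ 2) = C c * X ^ 1 + C (12 * d) * X ^ 3 := by
    rw [C_mul, show (C 12 : K[X]) = 12 from rfl]; ring
  rw [e] at h1
  have hc := h1 1 (by norm_num)
  have hd := h1 3 (by norm_num)
  simp [coeff_X_pow, -pow_one, -map_mul] at hc hd
  exact ⟨hc, by tauto⟩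

/-- The twisted G-signature identity comparing two equivariant lifts forces the
mod-`p` congruences from the order 0 and order 2 Taylor coefficients at `t = 1`. -/
theorem stmt11 (p : ℕ) (hp : p.Prime) (hp7 : 7 ≤ p) (ζ : ℂ) (hζ : IsPrimitiveRoot ζ p)
    (n m : ℕ) (a b lam : Fin n → ℤ) (a' b' lam' : Fin m → ℤ) (α c μ : ℤ)
    (ha : ∀ i, IsCoprime (a i) (p : ℤ)) (hb : ∀ i, IsCoprime (b i) (p : ℤ))
    (ha' : ∀ j, IsCoprime (a' j) (p : ℤ)) (hb' : ∀ j, IsCoprime (b' j) (p : ℤ))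
    (hc : IsCoprime c (p : ℤ))
    (h : Polynomial ℤ) (hh1 : (p : ℤ) ∣ h.eval 1)
    (hid : Polynomial.aeval ζ h
        = ∑ i, Lz ζ (a i) (b i) * (ζ ^ (lam i) + ζ ^ (-(lam i)))
          - ∑ j, Lz ζ (a' j) (b' j) * (ζ ^ (lam' j) + ζ ^ (-(lam' j)))
          + 4 * (α : ℂ) * ζ ^ c * (ζ ^ μ + ζ ^ (-μ)) / (ζ ^ c - 1) ^ 2) :
    (∑ i, ((a i * b i : ℤ) : ZMod p)⁻¹ - ∑ j, ((a' j * b' j : ℤ) : ZMod p)⁻¹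
        + (α : ZMod p) * ((c ^ 2 : ℤ) : ZMod p)⁻¹ = 0) ∧
    (∑ i, ((6 * (lam i) ^ 2 + (a i) ^ 2 + (b i) ^ 2 + 1 : ℤ) : ZMod p)
          * ((a i * b i : ℤ) : ZMod p)⁻¹
        - ∑ j, ((6 * (lam' j) ^ 2 + (a' j) ^ 2 + (b' j) ^ 2 + 1 : ℤ) : ZMod p)
            * ((a' j * b' j : ℤ) : ZMod p)⁻¹
        - (α : ZMod p) * ((c ^ 2 - 1 - 6 * μ ^ 2 : ℤ) : ZMod p)
            * ((c ^ 2 : ℤ) : ZMod p)⁻¹ = 0) := by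
  have : Fact p.Prime := ⟨hp⟩
  have hne : ∀ {k : ℤ}, IsCoprime k (p : ℤ) → (k : ZMod p) ≠ 0 := by
    intro k hk h0
    rw [ZMod.intCast_zmod_eq_zero_iff_dvd] at h0
    have h1 : IsUnit (p : ℤ) := hk.isUnit_of_dvd' h0 dvd_rfl
    exact (Nat.prime_iff_prime_int.mp hp).not_isUnit h1
  have h_unit : ∀ q : ℕ, q ≠ 0 → q < p → (q : ZMod p) ≠ 0 := by
    intro q h0 hq h1
    rw [ZMod.natCast_eq_zero_iff] at h1
    exact absurd (Nat.le_of_dvd (by omega) h1) (by omega)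
  have h2 : (2 : ZMod p) ≠ 0 := by exact_mod_cast h_unit 2 (by norm_num) (by omega)
  have h3 : (3 : ZMod p) ≠ 0 := by exact_mod_cast h_unit 3 (by norm_num) (by omega)
  have h12 : (12 : ZMod p) ≠ 0 := by
    rw [show (12 : ZMod p) = 2 * 2 * 3 by norm_num]
    exact mul_ne_zero (mul_ne_zero h2 h2) h3
  have h8 : (8 : ZMod p) ≠ 0 := by
    rw [show (8 : ZMod p) = 2 ^ 3 by norm_num]
    exact pow_ne_zero _ h2
  let A := AdjoinRoot (Polynomial.X ^ 4 : Polynomial (ZMod p))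
  let y : A := AdjoinRoot.root _
  have hy : y ^ 4 = 0 := by
    have := AdjoinRoot.mk_self (f := (Polynomial.X ^ 4 : Polynomial (ZMod p)))
    rwa [map_pow, AdjoinRoot.mk_X] at this
  let ι := algebraMap (ZMod p) A
  have hι : ∀ k : ℤ, ι (k : ZMod p) = (k : A) := fun k => map_intCast ι k
  have hw : (12 : A) * ι 12⁻¹ = 1 := by
    rw [show (12 : A) = ι 12 from (map_ofNat ι 12).symm, ← map_mul, mul_inv_cancel₀ h12, map_one]
  have hw8 : (8 : A) * ι 8⁻¹ = 1 := by
    rw [show (8 : A) = ι 8 from (map_ofNat ι 8).symm, ← map_mul, mul_inv_cancel₀ h8, map_one]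
  have hu : ∀ {k : ℤ}, IsCoprime k (p : ℤ) → (k : A) * ι (k : ZMod p)⁻¹ = 1 := by
    intro k hk
    rw [← hι, ← map_mul, mul_inv_cancel₀ (hne hk), map_one]
  have ht1 : truncExp y 1 - 1 = y * (12 + 72 * y + 288 * y ^ 2) := by
    simp only [truncExp]; ring
  let R := Algebra.adjoin ℤ {ζ}
  obtain ⟨φ, hφ⟩ : ∃ φ : R →+* A, φ ⟨ζ, Algebra.self_mem_adjoin_singleton ℤ ζ⟩ = truncExp y 1 :=
    exists_adjoin_ringHom hp hζ (truncExp y 1) (by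
    rw [ht1, mul_pow, ← Nat.sub_add_cancel (show 4 ≤ p - 1 by omega), pow_add y, hy]
    simp)
  have hzp : (⟨ζ, Algebra.self_mem_adjoin_singleton ℤ ζ⟩ : R) ^ p = 1 :=
    Subtype.ext hζ.pow_eq_one
  let z : Rˣ := Units.ofPowEqOne _ p hzp hp.ne_zero
  have hzval : ((z : R) : ℂ) = ζ := rfl
  have hzpow : z ^ p = 1 := Units.ext hzp
  have hzk : ∀ k : ℤ, (((z ^ k : Rˣ) : R) : ℂ) = ζ ^ k := by
    intro k
    have := map_zpow (Units.map (R.val : R →* ℂ)) z k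
    have := congrArg Units.val this
    rwa [Units.val_zpow_eq_zpow_val] at this
  have hφk : ∀ k : ℤ, φ ((z ^ k : Rˣ) : R) = truncExp y (k : A) :=
    map_zpow_eq_truncExp hy φ z hφ
  have hζ1 : ζ - 1 ≠ 0 := sub_ne_zero.mpr (hζ.ne_one hp.one_lt)
  have hex : ∀ k : ℤ, ∃ U : R, IsCoprime k (p : ℤ) →
      U * (((z ^ k : Rˣ) : R) - 1) = z - 1 := by
    intro k
    by_cases hk : IsCoprime k (p : ℤ)
    · obtain ⟨U, hU⟩ := exists_mul_zpow_sub_one z hzpow (hne hk)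
      exact ⟨U, fun _ => hU⟩
    · exact ⟨0, fun h => absurd h hk⟩
  choose U hU using hex
  have hUA : ∀ {k : ℤ}, IsCoprime k (p : ℤ) →
      φ (U k) * (truncExp y (k : A) - 1) = truncExp y 1 - 1 := by
    intro k hk
    have := congrArg φ (hU k hk)
    rw [map_mul, map_sub, map_sub, hφk, map_one] at this
    exact this.trans (by rw [← hφ]; rfl)
  have hUC : ∀ {k : ℤ}, IsCoprime k (p : ℤ) → ((U k : R) : ℂ) = (ζ - 1) / (ζ ^ k - 1) := by
    intro k hk
    have h1 : ((U k : R) : ℂ) * (ζ ^ k - 1) = ζ - 1 := by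
      rw [← hzk]; exact congrArg Subtype.val (hU k hk)
    rw [eq_div_iff, h1]
    intro h0
    rw [h0, mul_zero] at h1
    exact hζ1 h1.symm
  let T : ℤ → ℤ → ℤ → R := fun k l r => U k * (((z ^ k : Rˣ) : R) + 1) *
    (U l * (((z ^ l : Rˣ) : R) + 1)) * (((z ^ r : Rˣ) : R) + ((z ^ (-r) : Rˣ) : R))
  have hTC : ∀ {k l : ℤ} (r : ℤ), IsCoprime k (p : ℤ) → IsCoprime l (p : ℤ) →
      ((T k l r : R) : ℂ) = (ζ - 1) ^ 2 * (Lz ζ k l * (ζ ^ r + ζ ^ (-r))) := by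
    intro k l r hk hl
    simp only [T, MulMemClass.coe_mul, AddMemClass.coe_add, OneMemClass.coe_one, hzk, hUC hk,
      hUC hl, Lz]
    ring
  have hTA : ∀ {k l : ℤ} (r : ℤ), IsCoprime k (p : ℤ) → IsCoprime l (p : ℤ) →
      y * φ (T k l r) = 8 * (1 + 6 * y + 24 * y ^ 2) ^ 2
        * (y * (ι ((k * l : ℤ) : ZMod p)⁻¹
          + 12 * ι (((6 * r ^ 2 + k ^ 2 + l ^ 2 : ℤ) : ZMod p) * ((k * l : ℤ) : ZMod p)⁻¹)
            * y ^ 2)) := by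
    intro k l r hk hl
    have := fixedPoint_term hy (r := (r : A)) (hu hk) (hu hl) hw (hUA hk) (hUA hl)
    simp only [T, map_mul, map_add, map_one, hφk, Int.cast_neg]
    rw [this]
    simp only [Int.cast_mul, Int.cast_add, Int.cast_pow, Int.cast_ofNat, mul_inv, map_mul, map_add,
      map_pow, map_ofNat, hι]
  let S : R := 4 * (α : R) * ((z ^ c : Rˣ) : R) * U c ^ 2 *
    (((z ^ μ : Rˣ) : R) + ((z ^ (-μ) : Rˣ) : R))
  have hSC : (S : ℂ) = (ζ - 1) ^ 2 *
      (4 * (α : ℂ) * ζ ^ c * (ζ ^ μ + ζ ^ (-μ)) / (ζ ^ c - 1) ^ 2) := by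
    have h4 : ((4 : R) : ℂ) = 4 := rfl
    have hα : ((α : R) : ℂ) = α := map_intCast R.val α
    simp only [S, MulMemClass.coe_mul, AddMemClass.coe_add, SubmonoidClass.coe_pow, hzk, hUC hc,
      h4, hα, div_pow]
    ring
  have hSA : y * φ S = 8 * (1 + 6 * y + 24 * y ^ 2) ^ 2
      * (y * (ι ((α : ZMod p) * ((c ^ 2 : ℤ) : ZMod p)⁻¹)
        + 12 * ι ((α : ZMod p) * ((6 * μ ^ 2 - c ^ 2 : ℤ) : ZMod p) * ((c ^ 2 : ℤ) : ZMod p)⁻¹)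
          * y ^ 2)) := by
    have := fixedSphere_term hy (r := (μ : A)) (s := (α : A)) (hu hc) hw (hUA hc)
    simp only [S, map_mul, map_add, map_pow, map_ofNat, map_intCast, hφk, Int.cast_neg]
    rw [this]
    simp only [Int.cast_mul, Int.cast_sub, Int.cast_pow, Int.cast_ofNat, ← inv_pow, map_pow]
  have hidR : ((z : R) - 1) ^ 2 * Polynomial.aeval (z : R) h
      = ∑ i, T (a i) (b i) (lam i) - ∑ j, T (a' j) (b' j) (lam' j) + S := by
    apply Subtype.ext
    have hH : ((Polynomial.aeval (z : R) h : R) : ℂ) = Polynomial.aeval ζ h := by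
      rw [← hzval]; exact (Polynomial.aeval_algHom_apply R.val (z : R) h).symm
    simp only [MulMemClass.coe_mul, SubmonoidClass.coe_pow, AddMemClass.coe_add,
      AddSubgroupClass.coe_sub, AddSubmonoidClass.coe_finsetSum, hH, hid, hSC, hzval,
      OneMemClass.coe_one]
    rw [sum_congr rfl fun i _ => hTC (lam i) (ha i) (hb i),
      sum_congr rfl fun j _ => hTC (lam' j) (ha' j) (hb' j), ← mul_sum, ← mul_sum]
    ring
  have hleft : y * φ (((z : R) - 1) ^ 2 * Polynomial.aeval (z : R) h) = 0 := by
    obtain ⟨q, hq⟩ := Polynomial.X_sub_C_dvd_sub_C_eval (p := h) (a := 1)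
    obtain ⟨d, hd⟩ := hh1
    have hpA : (p : A) = 0 := by
      rw [← map_natCast ι, ZMod.natCast_self, map_zero]
    have h1 : φ (Polynomial.aeval (z : R) h)
        = y * (12 + 72 * y + 288 * y ^ 2) * φ (Polynomial.aeval (z : R) q) := by
      rw [sub_eq_iff_eq_add.mp hq, hd, ← ht1, ← hφ]
      simp [hpA]
      rfl
    have h2 : φ ((z : R) - 1) = y * (12 + 72 * y + 288 * y ^ 2) := by
      rw [map_sub, map_one, ← ht1, ← hφ]; rfl
    rw [map_mul, map_pow, h1, h2]
    linear_combination (12 + 72 * y + 288 * y ^ 2) ^ 3 * φ (Polynomial.aeval (z : R) q) * hy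
  rw [hidR, map_add, map_sub, map_sum, map_sum, mul_add, mul_sub, mul_sum, mul_sum,
    sum_congr rfl fun i _ => hTA (lam i) (ha i) (hb i),
    sum_congr rfl fun j _ => hTA (lam' j) (ha' j) (hb' j), hSA, ← mul_sum, ← mul_sum, ← mul_sum,
    ← mul_sum, sum_add_distrib, sum_add_distrib, ← sum_mul, ← sum_mul, ← mul_sum, ← mul_sum,
    ← map_sum, ← map_sum, ← map_sum, ← map_sum, ← mul_sub, ← mul_add, ← mul_sub, ← mul_add] at hleft
  have hcancel : ∀ B : A, 8 * (1 + 6 * y + 24 * y ^ 2) ^ 2 * (y * B) = 0 → y * B = 0 := by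
    intro B hB
    have he : (1 + 6 * y + 24 * y ^ 2) * (1 - 6 * y + 12 * y ^ 2) * y = y := by
      linear_combination (-72 + 288 * y) * hy
    linear_combination ι 8⁻¹ * (1 - 6 * y + 12 * y ^ 2) ^ 2 * hB
      - (1 + 6 * y + 24 * y ^ 2) ^ 2 * (1 - 6 * y + 12 * y ^ 2) ^ 2 * y * B * hw8
      - B * ((1 + 6 * y + 24 * y ^ 2) * (1 - 6 * y + 12 * y ^ 2) + 1) * he
  have hfin := hcancel _ hleft
  obtain ⟨hC, hD⟩ := eq_zero_of_root_mul_eq_zero h12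
    (c := ∑ i, ((a i * b i : ℤ) : ZMod p)⁻¹ - ∑ j, ((a' j * b' j : ℤ) : ZMod p)⁻¹
        + (α : ZMod p) * ((c ^ 2 : ℤ) : ZMod p)⁻¹)
    (d := ∑ i, ((6 * lam i ^ 2 + a i ^ 2 + b i ^ 2 : ℤ) : ZMod p) * ((a i * b i : ℤ) : ZMod p)⁻¹
      - ∑ j, ((6 * lam' j ^ 2 + a' j ^ 2 + b' j ^ 2 : ℤ) : ZMod p)
          * ((a' j * b' j : ℤ) : ZMod p)⁻¹
      + (α : ZMod p) * ((6 * μ ^ 2 - c ^ 2 : ℤ) : ZMod p) * ((c ^ 2 : ℤ) : ZMod p)⁻¹) (by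
    refine Eq.trans ?_ hfin
    simp only [map_add, map_sub, ι, y]
    ring)
  refine ⟨hC, ?_⟩
  have hsplit : ∀ (x : ℤ) (q : ZMod p), ((x + 1 : ℤ) : ZMod p) * q = (x : ZMod p) * q + q := by
    intro x q; push_cast; ring
  simp only [hsplit, sum_add_distrib]
  push_cast at hC hD ⊢
  linear_combination hC + hD
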